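/- arXiv:1311.5975 — 7 statements merged into one kernel-verified Lean document; each statement's English description precedes it below -/
import Mathlib

section
/- Let λ > 0 and set η = 2/(2 + λ + √(λ² + 4λ)), so that η ∈ (0,1). For every bounded sequence b : ℤ → ℝ, the sequence y : ℤ → ℝ defined by y_i = ((1−η)/(1+η)) · Σ_{j∈ℤ} η^{|i−j|} b_j is well defined (the series converges absolutely), is bounded, and satisfies λ y_i − (y_{i−1} − 2 y_i + y_{i+1}) = λ b_i for all i ∈ ℤ; moreover it is the unique bounded solution of this equation. -/
theorem hasSum_pow_natAbs_sub {r : ℝ} (h₀ : 0 < r) (h₁ : r < 1) (i : ℤ) :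
    HasSum (fun j : ℤ => r ^ (i - j).natAbs) (∑' k : ℤ, r ^ k.natAbs) := by
  have hs : Summable fun k : ℤ => r ^ k.natAbs := by
    have hg := summable_geometric_of_lt_one h₀.le h₁
    refine Summable.of_nat_of_neg ?_ ?_
    · simpa only [Int.natAbs_natCast] using hg
    · simpa only [Int.natAbs_neg, Int.natAbs_natCast] using hg
  exact (Equiv.hasSum_iff (Equiv.subLeft i) (f := fun k : ℤ => r ^ k.natAbs)).mpr hs.hasSum

/-- Up to normalization, `r ^ |k|` is the fundamental solution of `lam - Δ` when
`lam * r = (1 - r) ^ 2`. -/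
theorem pow_natAbs_fundamental_solution {r lam : ℝ}
    (h : lam * r = (1 - r) ^ 2) (k : ℤ) :
    (2 + lam) * r ^ k.natAbs - r ^ (k - 1).natAbs - r ^ (k + 1).natAbs =
      if k = 0 then 2 + lam - 2 * r else 0 := by
  obtain ⟨n, rfl | rfl⟩ := k.eq_nat_or_neg
  all_goals
    rcases n with _ | n
    · simp
      ring
  · have e₁ : ((n + 1 : ℕ) : ℤ).natAbs = n + 1 := by lia
    have e₂ : (((n + 1 : ℕ) : ℤ) - 1).natAbs = n := by lia
    have e₃ : (((n + 1 : ℕ) : ℤ) + 1).natAbs = n + 2 := by lia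
    rw [e₁, e₂, e₃, if_neg (by lia)]
    linear_combination r ^ n * h
  · have e₁ : (-((n + 1 : ℕ) : ℤ)).natAbs = n + 1 := by lia
    have e₂ : (-((n + 1 : ℕ) : ℤ) - 1).natAbs = n + 2 := by lia
    have e₃ : (-((n + 1 : ℕ) : ℤ) + 1).natAbs = n := by lia
    rw [e₁, e₂, e₃, if_neg (by lia)]
    linear_combination r ^ n * h

/-- A bounded solution of the homogeneous equation `lam * z = Δz` with `lam > 0` vanishes. -/
theorem eq_zero_of_bounded_of_mul_eq_laplacian {lam : ℝ} (hlam : 0 < lam) {z : ℤ → ℝ}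
    (hz : ∃ C : ℝ, ∀ i, |z i| ≤ C)
    (h : ∀ i, lam * z i - (z (i - 1) - 2 * z i + z (i + 1)) = 0) (i : ℤ) : z i = 0 := by
  obtain ⟨C, hC⟩ := hz
  have hle : ∀ i, |z i| ≤ ⨆ i, |z i| :=
    le_ciSup (f := fun i => |z i|) ⟨C, by rintro _ ⟨i, rfl⟩; exact hC i⟩
  have hM : ⨆ i, |z i| ≤ 2 * (⨆ i, |z i|) / (2 + lam) := by
    refine ciSup_le fun i => ?_
    rw [le_div_iff₀ (by positivity)]
    calc |z i| * (2 + lam) = |z (i - 1) + z (i + 1)| := by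
          rw [← abs_of_pos (show 0 < 2 + lam by positivity), ← abs_mul]
          congr 1
          linear_combination h i
      _ ≤ |z (i - 1)| + |z (i + 1)| := abs_add_le _ _
      _ ≤ 2 * ⨆ i, |z i| := by linarith [hle (i - 1), hle (i + 1)]
  rw [le_div_iff₀ (by positivity)] at hM
  have hM₀ : ⨆ i, |z i| ≤ 0 := by
    by_contra! hpos
    nlinarith
  exact abs_nonpos_iff.mp ((hle i).trans hM₀)

/-- **Explicit bounded solution of the static FLR equation.**
For `λ > 0` and `η = 2/(2 + λ + √(λ² + 4λ))` one has `η ∈ (0,1)`, and for every bounded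
sequence `b : ℤ → ℝ` the sequence `y_i = ((1-η)/(1+η)) ∑_{j} η^{|i-j|} b_j` is well defined
(the series converges absolutely), bounded, solves `λ y_i − (Δy)_i = λ b_i`, and is the
unique bounded solution of this equation. -/
theorem explicit_bounded_solution
    (lam : ℝ) (hlam : 0 < lam)
    (η : ℝ) (hη : η = 2 / (2 + lam + Real.sqrt (lam ^ 2 + 4 * lam)))
    (b : ℤ → ℝ) (hb : ∃ C : ℝ, ∀ i : ℤ, |b i| ≤ C)
    (y : ℤ → ℝ)
    (hy : y = fun i : ℤ => (1 - η) / (1 + η) * ∑' j : ℤ, η ^ (i - j).natAbs * b j) :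
    (0 < η ∧ η < 1) ∧
    (∀ i : ℤ, Summable fun j : ℤ => |η ^ (i - j).natAbs * b j|) ∧
    (∃ C : ℝ, ∀ i : ℤ, |y i| ≤ C) ∧
    (∀ i : ℤ, lam * y i - (y (i - 1) - 2 * y i + y (i + 1)) = lam * b i) ∧
    (∀ y' : ℤ → ℝ, (∃ C : ℝ, ∀ i : ℤ, |y' i| ≤ C) →
      (∀ i : ℤ, lam * y' i - (y' (i - 1) - 2 * y' i + y' (i + 1)) = lam * b i) →
      y' = y) := by
  have hD : 0 < 2 + lam + √(lam ^ 2 + 4 * lam) := by positivity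
  have h₀ : 0 < η := by rw [hη]; positivity
  have h₁ : η < 1 := by
    rw [hη, div_lt_one hD]
    linarith [Real.sqrt_nonneg (lam ^ 2 + 4 * lam)]
  have hq : lam * η = (1 - η) ^ 2 := by
    have hs : √(lam ^ 2 + 4 * lam) ^ 2 = lam ^ 2 + 4 * lam := Real.sq_sqrt (by positivity)
    rw [hη]
    generalize √(lam ^ 2 + 4 * lam) = s at hs hD ⊢
    field_simp
    linear_combination -hs
  obtain ⟨C, hC⟩ := hb
  have hK := hasSum_pow_natAbs_sub h₀ h₁
  have hle : ∀ i j : ℤ, ‖η ^ (i - j).natAbs * b j‖ ≤ η ^ (i - j).natAbs * C := by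
    intro i j
    rw [norm_mul, Real.norm_of_nonneg (by positivity)]
    exact mul_le_mul_of_nonneg_left (hC j) (by positivity)
  have habs : ∀ i : ℤ, Summable fun j : ℤ => |η ^ (i - j).natAbs * b j| := fun i =>
    Summable.of_nonneg_of_le (fun _ => abs_nonneg _) (hle i) ((hK i).mul_right C).summable
  have hbdd : ∃ C : ℝ, ∀ i : ℤ, |y i| ≤ C := by
    refine ⟨|(1 - η) / (1 + η)| * ((∑' k : ℤ, η ^ k.natAbs) * C), fun i => ?_⟩
    rw [hy, abs_mul]
    exact mul_le_mul_of_nonneg_left (tsum_of_norm_bounded ((hK i).mul_right C) (hle i))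
      (abs_nonneg _)
  have heq : ∀ i : ℤ, lam * y i - (y (i - 1) - 2 * y i + y (i + 1)) = lam * b i := by
    intro i
    have hS := fun i => (habs i).of_abs.hasSum
    have h := (((hS i).mul_left (2 + lam)).sub (hS (i - 1))).sub (hS (i + 1))
    have hterm : (fun j : ℤ => (2 + lam) * (η ^ (i - j).natAbs * b j)
        - η ^ (i - 1 - j).natAbs * b j - η ^ (i + 1 - j).natAbs * b j) =
        fun j => if j = i then (2 + lam - 2 * η) * b i else 0 := by
      funext j
      have hj := pow_natAbs_fundamental_solution hq (i - j)
      rw [show i - j - 1 = i - 1 - j by ring, show i - j + 1 = i + 1 - j by ring] at hj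
      split_ifs with hij
      · subst hij
        rw [if_pos (sub_self j)] at hj
        linear_combination b j * hj
      · rw [if_neg (by lia)] at hj
        linear_combination b j * hj
    rw [hterm] at h
    have hsum := h.unique (hasSum_ite_eq i _)
    have hc : (1 - η) / (1 + η) * (2 + lam - 2 * η) = lam := by
      field_simp
      linear_combination -2 * hq
    simp only [hy]
    linear_combination (1 - η) / (1 + η) * hsum + b i * hc
  refine ⟨⟨h₀, h₁⟩, habs, hbdd, heq, fun y' ⟨A, hA⟩ hy' => ?_⟩
  obtain ⟨B, hB⟩ := hbdd
  funext i
  refine sub_eq_zero.mp (eq_zero_of_bounded_of_mul_eq_laplacian hlam (z := fun i => y' i - y i)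
    ⟨A + B, fun i => (abs_sub _ _).trans (add_le_add (hA i) (hB i))⟩ (fun i => ?_) i)
  linear_combination hy' i - heq i
end

section
/- Let L ≥ 1 be an integer. A vector ℓ : ZMod L → ℤ equals the periodic discrete Laplacian Δm of some m : ZMod L → ℤ if and only if both (i) Σ_{i=0}^{L−1} ℓ_i = 0 and (ii) Σ_{i=0}^{L−1} i·ℓ_i ≡ 0 (mod L). -/
/-- The periodic discrete Laplacian on integer sequences indexed by `ZMod L`. -/
def lapZ {L : ℕ} (v : ZMod L → ℤ) (i : ZMod L) : ℤ :=
  v (i - 1) - 2 * v i + v (i + 1)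

/-- A function on `ZMod L` is a periodic first difference iff its sum over a period vanishes. -/
theorem exists_periodic_primitive_iff {L : ℕ} (hL : 1 ≤ L) (f : ZMod L → ℤ) :
    (∃ g : ZMod L → ℤ, ∀ i, g (i + 1) - g i = f i) ↔ ∑ i ∈ Finset.range L, f (i : ZMod L) = 0 := by
  have : NeZero L := ⟨by omega⟩
  constructor
  · rintro ⟨g, hg⟩
    have h := Finset.sum_range_sub (fun n : ℕ => g (n : ZMod L)) L
    simpa [hg] using h
  · intro hf
    refine ⟨fun i => ∑ k ∈ Finset.range i.val, f (k : ZMod L), fun i => ?_⟩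
    have hi : ((i.val : ℕ) : ZMod L) = i := ZMod.natCast_zmod_val i
    have hsucc := Finset.sum_range_succ (fun k : ℕ => f (k : ZMod L)) i.val
    rw [hi] at hsucc
    have hcast : ((i.val + 1 : ℕ) : ZMod L) = i + 1 := by rw [Nat.cast_add, hi, Nat.cast_one]
    rcases (show i.val + 1 ≤ L from i.val_lt).lt_or_eq with hlt | heq
    · have hval : (i + 1).val = i.val + 1 := by rw [← hcast, ZMod.val_cast_of_lt hlt]
      simp only [hval, hsucc]
      ring
    · have hval : i + 1 = 0 := by rw [← hcast, (ZMod.natCast_eq_zero_iff _ _).2 heq.symm.dvd]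
      rw [heq, hf] at hsucc
      simp only [hval, ZMod.val_zero, Finset.range_zero, Finset.sum_empty]
      linarith

/-- Summation by parts against the identity. -/
theorem sum_range_mul_sub (u : ℕ → ℤ) (n : ℕ) :
    ∑ i ∈ Finset.range n, (i : ℤ) * (u (i + 1) - u i) =
      n * u n - ∑ i ∈ Finset.range n, u (i + 1) := by
  induction n with
  | zero => simp
  | succ n ih =>
    rw [Finset.sum_range_succ, Finset.sum_range_succ, ih]
    push_cast
    ring

/-- The first moment of a periodic first difference over one period. -/
theorem sum_range_mul_of_periodic_sub {L : ℕ} {u ℓ : ZMod L → ℤ}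
    (hu : ∀ i, u (i + 1) - u i = ℓ i) :
    ∑ i ∈ Finset.range L, (i : ℤ) * ℓ (i : ZMod L) =
      L * u 0 - ∑ i ∈ Finset.range L, u ((i : ZMod L) + 1) := by
  simpa [hu] using sum_range_mul_sub (fun n : ℕ => u (n : ZMod L)) L

/-- **Invertibility of the periodic discrete Laplacian.**
For `L ≥ 1`, a vector `ℓ : ZMod L → ℤ` equals `Δm` for some `m : ZMod L → ℤ` if and only if
`Σ_{i=0}^{L-1} ℓ_i = 0` and `Σ_{i=0}^{L-1} i·ℓ_i ≡ 0 (mod L)`. -/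
theorem laplacian_range_iff (L : ℕ) (hL : 1 ≤ L) (ℓ : ZMod L → ℤ) :
    (∃ m : ZMod L → ℤ, ∀ i : ZMod L, lapZ m i = ℓ i) ↔
      ((∑ i ∈ Finset.range L, ℓ (i : ZMod L)) = 0 ∧
        (L : ℤ) ∣ ∑ i ∈ Finset.range L, (i : ℤ) * ℓ (i : ZMod L)) := by
  constructor
  · rintro ⟨m, hm⟩
    have hu : ∀ i, (fun j => m j - m (j - 1)) (i + 1) - (fun j => m j - m (j - 1)) i = ℓ i := by
      intro i
      rw [← hm i, lapZ]
      simp only [add_sub_cancel_right]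
      ring
    refine ⟨(exists_periodic_primitive_iff hL ℓ).1 ⟨fun j => m j - m (j - 1), hu⟩, ?_⟩
    have hsum := (exists_periodic_primitive_iff hL (fun i => m (i + 1) - m i)).1 ⟨m, fun _ => rfl⟩
    rw [sum_range_mul_of_periodic_sub (u := fun j => m j - m (j - 1)) hu]
    simp only [add_sub_cancel_right]
    rw [hsum, sub_zero]
    exact dvd_mul_right _ _
  · rintro ⟨hsum, hdvd⟩
    obtain ⟨u, hu⟩ := (exists_periodic_primitive_iff hL ℓ).2 hsum
    rw [sum_range_mul_of_periodic_sub hu, dvd_sub_right (dvd_mul_right _ _)] at hdvd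
    obtain ⟨c, hc⟩ := hdvd
    obtain ⟨m, hm⟩ := (exists_periodic_primitive_iff hL (fun i => u (i + 1) - c)).2 (by
      simp [Finset.sum_sub_distrib, hc])
    refine ⟨m, fun i => ?_⟩
    have h₁ := hm i
    have h₂ := hm (i - 1)
    simp only [sub_add_cancel] at h₁ h₂
    rw [lapZ, ← hu i]
    linarith
end

section
/- Let L ≥ 2 and α : ZMod L → ℝ be such that the values ω_i are pairwise distinct. Define J : ZMod L → ℤ as follows: if S ≥ 0, then J_i = 1 for the S+1 indices i with smallest ω_i and J_i = 0 otherwise; if S < 0, then J_i = −1 for the |S|−1 indices i with largest ω_i and J_i = 0 otherwise. Let k⁺ ∈ ZMod L be given by k⁺ ≡ Σ_{i=0}^{L−1} i·(−⌊(Δα)_i⌉ + J_i) (mod L). Then: (a) the vector ℓ_i = −⌊(Δα)_i⌉ + J_i − δ_{i k⁺} satisfies Σ_i ℓ_i = 0 and Σ_i i ℓ_i ≡ 0 (mod L), so there exists m⁺ : ZMod L → ℤ with Δm⁺ = ℓ; and (b) m⁺ is a threshold configuration: for every m : ZMod L → ℤ, max_i ((Δm⁺)_i + (Δα)_i) ≤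 max_i ((Δm)_i + (Δα)_i). -/
/-- The periodic discrete Laplacian on real sequences indexed by `ZMod L`. -/
def lapR {L : ℕ} (v : ZMod L → ℝ) (i : ZMod L) : ℝ :=
  v (i - 1) - 2 * v i + v (i + 1)

/-- Rescaled well coordinates of the toy CDW model: `z(m)_i = (Δm)_i + (Δα)_i`. -/
noncomputable def zco {L : ℕ} (α : ZMod L → ℝ) (m : ZMod L → ℤ) (i : ZMod L) : ℝ :=
  (lapZ m i : ℝ) + lapR α i

/-- `max_i z(m)_i` over the (finite, nonempty) set of sites. -/
noncomputable def zmax {L : ℕ} [NeZero L] (α : ZMod L → ℝ) (m : ZMod L → ℤ) : ℝ :=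
  Finset.univ.sup' ⟨0, Finset.mem_univ 0⟩ (zco α m)

/-- `ω_i = (Δα)_i − ⌊(Δα)_i⌉`, the fractional part of the Laplacian of the disorder. -/
noncomputable def omegaF {L : ℕ} (α : ZMod L → ℝ) (i : ZMod L) : ℝ :=
  lapR α i - round (lapR α i)

open Finset in
/-- For an injective `f`, exactly `n` points have fewer than `n` points strictly below them. -/
theorem card_filter_rank_lt {ι β : Type*} [Fintype ι] [LinearOrder β] {f : ι → β}
    (hf : Function.Injective f) {n : ℕ} (hn : n ≤ Fintype.card ι) :
    (univ.filter fun i => (univ.filter fun j => f j < f i).card < n).card = n := by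
  classical
  set r : ι → ℕ := fun i => (univ.filter fun j => f j < f i).card with hr
  have hmono : ∀ i j, f i < f j → r i < r j := by
    intro i j hij
    refine card_lt_card ⟨fun x hx => ?_, fun hsub => ?_⟩
    · simp only [mem_filter, mem_univ, true_and] at hx ⊢
      exact hx.trans hij
    · have hi : i ∈ univ.filter fun x => f x < f i := hsub (by simpa using hij)
      simp at hi
  have hinj : Function.Injective r := by
    intro i j hij
    rcases lt_trichotomy (f i) (f j) with h | h | h
    · exact absurd hij (hmono i j h).ne
    · exact hf h
    · exact absurd hij (hmono j i h).ne'
  have himage : univ.image r = range (Fintype.card ι) := by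
    refine eq_of_subset_of_card_le (fun x hx => ?_) ?_
    · obtain ⟨i, -, rfl⟩ := mem_image.1 hx
      refine mem_range.2 (card_lt_card ⟨subset_univ _, fun hsub => ?_⟩)
      have hi := hsub (mem_univ i)
      simp at hi
    · rw [card_image_of_injective _ hinj, card_range, card_univ]
  calc (univ.filter fun i => r i < n).card
      = ((univ.filter fun i => r i < n).image r).card := (card_image_of_injective _ hinj).symm
    _ = (range n).card := by
        congr 1
        ext x
        simp only [mem_image, mem_filter, mem_univ, true_and, mem_range]
        constructor
        · rintro ⟨i, hi, rfl⟩
          exact hi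
        · intro hx
          have hx' : x ∈ univ.image r := by
            rw [himage]
            exact mem_range.2 (hx.trans_le hn)
          obtain ⟨i, -, rfl⟩ := mem_image.1 hx'
          exact ⟨i, hx, rfl⟩
    _ = n := card_range n

section PeriodicSums

variable {L : ℕ} [NeZero L]

theorem sum_comp_add_one {M : Type*} [AddCommMonoid M] (f : ZMod L → M) :
    ∑ i, f (i + 1) = ∑ i, f i :=
  Equiv.sum_comp (Equiv.addRight (1 : ZMod L)) f

theorem sum_comp_sub_one {M : Type*} [AddCommMonoid M] (f : ZMod L → M) :
    ∑ i, f (i - 1) = ∑ i, f i :=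
  Equiv.sum_comp (Equiv.subRight (1 : ZMod L)) f

theorem sum_lapZ (v : ZMod L → ℤ) : ∑ i, lapZ v i = 0 := by
  simp only [lapZ, Finset.sum_add_distrib, Finset.sum_sub_distrib, ← Finset.mul_sum,
    sum_comp_add_one v, sum_comp_sub_one v]
  ring

theorem sum_lapR (v : ZMod L → ℝ) : ∑ i, lapR v i = 0 := by
  simp only [lapR, Finset.sum_add_distrib, Finset.sum_sub_distrib, ← Finset.mul_sum,
    sum_comp_add_one v, sum_comp_sub_one v]
  ring

/-- Discrete integration by parts on the cycle, for the weight `i ↦ i` modulo `L`. -/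
theorem sum_self_mul_sub (d : ZMod L → ZMod L) :
    ∑ i : ZMod L, i * (d i - d (i - 1)) = -∑ i, d i := by
  have h := sum_comp_sub_one fun i : ZMod L => (i + 1) * d i
  simp only [sub_add_cancel, add_mul, one_mul, Finset.sum_add_distrib] at h
  simp only [mul_sub, Finset.sum_sub_distrib, h]
  ring

theorem sum_self_mul_lapZ (v : ZMod L → ℤ) :
    ∑ i : ZMod L, i * (lapZ v i : ZMod L) = 0 := by
  have h := sum_self_mul_sub fun i : ZMod L => (v (i + 1) - v i : ZMod L)
  rw [Finset.sum_sub_distrib, sum_comp_add_one fun i => (v i : ZMod L), sub_self, neg_zero] at h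
  rw [← h]
  refine Finset.sum_congr rfl fun i _ => ?_
  simp only [lapZ, sub_add_cancel]
  push_cast
  ring

/-- A function on the cycle with zero sum is a discrete derivative. -/
theorem exists_forward_difference (f : ZMod L → ℤ) (hf : ∑ i, f i = 0) :
    ∃ F : ZMod L → ℤ, ∀ i, F (i + 1) - F i = f i := by
  have htotal : ∑ k ∈ Finset.range L, f (k : ZMod L) = 0 := by
    rw [← hf]
    refine Finset.sum_bij' (fun k _ => (k : ZMod L)) (fun i _ => i.val) (by simp)
      (fun i _ => Finset.mem_range.2 i.val_lt) (fun k hk => ?_) (by simp) (by simp)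
    exact ZMod.val_cast_of_lt (Finset.mem_range.1 hk)
  refine ⟨fun i => ∑ k ∈ Finset.range i.val, f (k : ZMod L), fun i => ?_⟩
  have hsucc : ∑ k ∈ Finset.range (i.val + 1), f (k : ZMod L)
      = ∑ k ∈ Finset.range i.val, f (k : ZMod L) + f i := by
    rw [Finset.sum_range_succ, ZMod.natCast_zmod_val]
  have hcast : i + 1 = ((i.val + 1 : ℕ) : ZMod L) := by simp
  rcases (Nat.succ_le_of_lt i.val_lt).lt_or_eq with h | h
  · have hval : (i + 1).val = i.val + 1 := by rw [hcast, ZMod.val_cast_of_lt h]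
    simp only [hval, hsucc]
    ring
  · have hval : i + 1 = 0 := by rw [hcast, show i.val + 1 = L from h, ZMod.natCast_self]
    rw [show i.val + 1 = L from h, htotal] at hsucc
    simp only [hval, ZMod.val_zero, Finset.range_zero, Finset.sum_empty]
    linarith

/-- Solvability of the periodic discrete Poisson equation over the integers. -/
theorem exists_lapZ_eq (f : ZMod L → ℤ) (hf : ∑ i, f i = 0)
    (hmod : ∑ i : ZMod L, i * (f i : ZMod L) = 0) : ∃ v : ZMod L → ℤ, ∀ i, lapZ v i = f i := by
  obtain ⟨d, hd⟩ := exists_forward_difference (fun i => f (i + 1)) (by rw [sum_comp_add_one, hf])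
  have hd' : ∀ i, d i - d (i - 1) = f i := fun i => by simpa using hd (i - 1)
  have hdvd : (L : ℤ) ∣ ∑ i, d i := by
    rw [← ZMod.intCast_zmod_eq_zero_iff_dvd _ L]
    have h := sum_self_mul_sub fun i => (d i : ZMod L)
    have h' : ∑ i : ZMod L, i * ((d i : ZMod L) - d (i - 1)) = 0 := by
      rw [← hmod]
      refine Finset.sum_congr rfl fun i _ => ?_
      rw [← hd' i]
      push_cast
      ring
    rw [h'] at h
    push_cast
    exact neg_eq_zero.1 h.symm
  obtain ⟨a, ha⟩ := hdvd
  obtain ⟨v, hv⟩ := exists_forward_difference (fun i => d i - a) (by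
    rw [Finset.sum_sub_distrib, ha]
    simp [ZMod.card])
  refine ⟨v, fun i => ?_⟩
  have h₁ := hv i
  have h₂ := hv (i - 1)
  have h₃ := hd' i
  simp only [sub_add_cancel] at h₂
  simp only [lapZ]
  linarith

end PeriodicSums

section Fractional

variable {L : ℕ}

theorem neg_half_le_omegaF (α : ZMod L → ℝ) (i : ZMod L) : -(1 / 2) ≤ omegaF α i := by
  have h := Int.floor_le (lapR α i + 1 / 2)
  rw [← round_eq] at h
  simp only [omegaF]
  linarith

theorem omegaF_lt_half (α : ZMod L → ℝ) (i : ZMod L) : omegaF α i < 1 / 2 := by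
  have h := Int.lt_floor_add_one (lapR α i + 1 / 2)
  rw [← round_eq] at h
  simp only [omegaF]
  linarith

theorem sum_omegaF [NeZero L] (α : ZMod L → ℝ) :
    ∑ i, omegaF α i = -((∑ i, round (lapR α i) : ℤ) : ℝ) := by
  simp only [omegaF, Finset.sum_sub_distrib, sum_lapR]
  push_cast
  ring

theorem two_mul_abs_sum_round_le [NeZero L] (α : ZMod L → ℝ) :
    2 * |∑ i, round (lapR α i)| ≤ (L : ℤ) := by
  have hlo : ∑ _i : ZMod L, (-(1 / 2) : ℝ) ≤ ∑ i, omegaF α i :=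
    Finset.sum_le_sum fun i _ => neg_half_le_omegaF α i
  have hhi : ∑ i, omegaF α i ≤ ∑ _i : ZMod L, (1 / 2 : ℝ) :=
    Finset.sum_le_sum fun i _ => (omegaF_lt_half α i).le
  rw [sum_omegaF] at hlo hhi
  simp only [Finset.sum_const, Finset.card_univ, ZMod.card, nsmul_eq_mul] at hlo hhi
  have h : |((∑ i, round (lapR α i) : ℤ) : ℝ)| ≤ L / 2 := abs_le.2 ⟨by linarith, by linarith⟩
  have h' : 2 * |((∑ i, round (lapR α i) : ℤ) : ℝ)| ≤ L := by linarith
  exact_mod_cast h'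

end Fractional

/-- A correction `n` of total one less than `J` which keeps `ω + n` strictly below
the maximum `ω c + J c` must be `J - δ_c`, provided `ω + J` has oscillation less than one. -/
theorem eq_sub_single_of_lt {ι : Type*} [Fintype ι] [DecidableEq ι] {ω : ι → ℝ} {J n : ι → ℤ}
    {c : ι} (hosc : ∀ i, ω c + J c < ω i + J i + 1) (hsum : ∑ i, n i = ∑ i, J i - 1)
    (hlt : ∀ i, ω i + n i < ω c + J c) (i : ι) : n i = J i - if i = c then 1 else 0 := by
  have hle : ∀ i ∈ Finset.univ, n i ≤ J i - if i = c then 1 else 0 := by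
    intro i _
    split_ifs with h
    · have h' := hlt i
      rw [h] at h' ⊢
      have : (n c : ℝ) < J c := by linarith
      have : n c < J c := by exact_mod_cast this
      omega
    · have : (n i : ℝ) < J i + 1 := by linarith [hlt i, hosc i]
      have : n i < J i + 1 := by exact_mod_cast this
      omega
  refine (Finset.sum_eq_sum_iff_of_le hle).1 ?_ i (Finset.mem_univ i)
  rw [hsum, Finset.sum_sub_distrib]
  simp

open Classical in
/-- **Explicit threshold configuration of the toy model (Theorem 4.1).**
With `S = Σ_i ⌊(Δα)_i⌉`, `J` selecting the `S+1` smallest (resp. `|S|−1` largest) values of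
`ω` when `S ≥ 0` (resp. `S < 0`), and `k⁺ ≡ Σ_i i·(−⌊(Δα)_i⌉ + J_i) (mod L)`, the vector
`ℓ_i = −⌊(Δα)_i⌉ + J_i − δ_{i k⁺}` sums to zero, satisfies the mod-`L` divisibility
condition (hence is `Δm⁺` for some `m⁺`), and any such `m⁺` is a threshold configuration. -/
theorem toy_threshold_explicit (L : ℕ) [NeZero L] (hL : 2 ≤ L) (α : ZMod L → ℝ)
    (hdist : Function.Injective (omegaF α))
    (S : ℤ) (hS : S = ∑ i : ZMod L, round (lapR α i))
    (J : ZMod L → ℤ)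
    (hJpos : 0 ≤ S → ∀ i : ZMod L, J i =
      if ((Finset.univ.filter fun j => omegaF α j < omegaF α i).card : ℤ) < S + 1
      then 1 else 0)
    (hJneg : S < 0 → ∀ i : ZMod L, J i =
      if ((Finset.univ.filter fun j => omegaF α i < omegaF α j).card : ℤ) < |S| - 1
      then -1 else 0)
    (kplus : ZMod L)
    (hk : kplus = ((∑ i : ZMod L, (i.val : ℤ) * (-(round (lapR α i)) + J i) : ℤ) : ZMod L))
    (ℓ : ZMod L → ℤ)
    (hℓ : ∀ i : ZMod L, ℓ i = -(round (lapR α i)) + J i - if i = kplus then 1 else 0) :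
    (∑ i : ZMod L, ℓ i = 0) ∧
    ((L : ℤ) ∣ ∑ i : ZMod L, (i.val : ℤ) * ℓ i) ∧
    (∃ mplus : ZMod L → ℤ, ∀ i : ZMod L, lapZ mplus i = ℓ i) ∧
    (∀ mplus : ZMod L → ℤ, (∀ i : ZMod L, lapZ mplus i = ℓ i) →
      ∀ m : ZMod L → ℤ, zmax α mplus ≤ zmax α m) := by
  have hbound := two_mul_abs_sum_round_le α
  rw [← hS] at hbound
  have hJsum : ∑ i, J i = S + 1 := by
    rcases le_or_gt 0 S with h | h
    · obtain ⟨s, rfl⟩ := Int.eq_ofNat_of_zero_le h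
      rw [abs_of_nonneg h] at hbound
      have hcard := card_filter_rank_lt hdist (n := s + 1) (by rw [ZMod.card]; omega)
      simp only [hJpos h, Finset.sum_boole]
      exact_mod_cast hcard
    · obtain ⟨s, hs⟩ := Int.eq_ofNat_of_zero_le (show 0 ≤ -S - 1 by omega)
      rw [abs_of_neg h] at hbound hJneg
      have hcard := card_filter_rank_lt (f := fun i => -omegaF α i)
        (neg_injective.comp hdist) (n := s) (by rw [ZMod.card]; omega)
      simp only [neg_lt_neg_iff] at hcard
      have hJ : ∀ i, J i =
          -if (Finset.univ.filter fun j => omegaF α i < omegaF α j).card < s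
          then 1 else 0 := by
        intro i
        rw [hJneg h i, hs]
        simp only [Nat.cast_lt]
        split_ifs <;> rfl
      simp only [hJ, Finset.sum_neg_distrib, Finset.sum_boole]
      have hcard' : ((Finset.univ.filter fun i : ZMod L =>
          (Finset.univ.filter fun j => omegaF α i < omegaF α j).card < s).card : ℤ) = s := by
        exact_mod_cast hcard
      rw [hcard']
      omega
  have hosc : ∀ i j, omegaF α i + J i < omegaF α j + J j + 1 := by
    intro i j
    have hi₁ := neg_half_le_omegaF α i
    have hi₂ := omegaF_lt_half α i
    have hj₁ := neg_half_le_omegaF α j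
    have hj₂ := omegaF_lt_half α j
    rcases lt_or_ge (omegaF α i) (omegaF α j) with hij | hij
    · have hJ : (J i : ℝ) ≤ J j + 1 := by
        have : J i ≤ J j + 1 := by
          rcases le_or_gt 0 S with h | h
          · rw [hJpos h i, hJpos h j]; split_ifs <;> norm_num
          · rw [hJneg h i, hJneg h j]; split_ifs <;> norm_num
        exact_mod_cast this
      linarith
    · have hJ : (J i : ℝ) ≤ J j := by
        have : J i ≤ J j := by
          rcases le_or_gt 0 S with h | h
          · have hcard : ((Finset.univ.filter fun k => omegaF α k < omegaF α j).card : ℤ)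
                ≤ (Finset.univ.filter fun k => omegaF α k < omegaF α i).card :=
              Int.ofNat_le.2 (Finset.card_le_card
                (Finset.monotone_filter_right _ fun k _ hk => lt_of_lt_of_le hk hij))
            rw [hJpos h i, hJpos h j]
            split_ifs <;> omega
          · have hcard : ((Finset.univ.filter fun k => omegaF α i < omegaF α k).card : ℤ)
                ≤ (Finset.univ.filter fun k => omegaF α j < omegaF α k).card :=
              Int.ofNat_le.2 (Finset.card_le_card
                (Finset.monotone_filter_right _ fun k _ hk => lt_of_le_of_lt hij hk))
            rw [hJneg h i, hJneg h j]
            split_ifs <;> omega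
        exact_mod_cast this
      linarith
  push_cast at hk
  simp only [ZMod.natCast_zmod_val] at hk
  have hℓsum : ∑ i, ℓ i = 0 := by
    simp only [hℓ, Finset.sum_sub_distrib, Finset.sum_add_distrib, Finset.sum_neg_distrib,
      ← hS, hJsum]
    simp
  have hmoment : ∀ c : ZMod L,
      ∑ i : ZMod L, i * ((-round (lapR α i) + J i - if i = c then 1 else 0 : ℤ) : ZMod L)
        = kplus - c := by
    intro c
    rw [hk]
    push_cast
    simp only [mul_sub, Finset.sum_sub_distrib]
    simp
  have hℓmod : ∑ i : ZMod L, i * (ℓ i : ZMod L) = 0 := by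
    simp only [hℓ, hmoment, sub_self]
  refine ⟨hℓsum, ?_, exists_lapZ_eq ℓ hℓsum hℓmod, fun mplus hmplus m => ?_⟩
  · rw [← ZMod.intCast_zmod_eq_zero_iff_dvd _ L]
    push_cast
    simpa using hℓmod
  by_contra! hlt
  obtain ⟨c, -, hc⟩ := Finset.exists_max_image Finset.univ (fun i => omegaF α i + J i)
    ⟨0, Finset.mem_univ 0⟩
  have hplus : zmax α mplus ≤ omegaF α c + J c := by
    refine Finset.sup'_le _ _ fun i _ => ?_
    have hi := hc i (Finset.mem_univ i)
    have hδ : (0 : ℝ) ≤ if i = kplus then 1 else 0 := by split_ifs <;> norm_num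
    simp only [zco, hmplus, hℓ]
    simp only [omegaF] at hi ⊢
    push_cast
    linarith
  have hn := eq_sub_single_of_lt (ω := omegaF α) (J := J)
    (n := fun i => lapZ m i + round (lapR α i)) (hosc c)
    (by rw [Finset.sum_add_distrib, sum_lapZ, ← hS, hJsum]; ring)
    (fun i => by
      have hi : zco α m i ≤ zmax α m := Finset.le_sup' (zco α m) (Finset.mem_univ i)
      simp only [zco] at hi
      have hω : omegaF α i = lapR α i - round (lapR α i) := rfl
      push_cast
      linarith)
  have hm : ∀ i, lapZ m i = -round (lapR α i) + J i - if i = c then 1 else 0 := fun i => by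
    linarith [hn i]
  have hkc : kplus = c := by
    have h := hmoment c
    simp only [← hm, sum_self_mul_lapZ] at h
    exact (sub_eq_zero.1 h.symm)
  have heq : zco α m = zco α mplus := by
    funext i
    simp only [zco, hmplus, hℓ, hm, hkc]
  simp only [zmax, heq, lt_self_iff_false] at hlt
end

section
/- Let L ≥ 1, α : ZMod L → ℝ, and m⁰ : ZMod L → ℤ with record M = max_i z(m⁰)_i. Consider any finite sequence m⁰, m¹, …, m^k of configurations in which m^{n+1} = m^n + e_{j_n} (e_j the indicator vector of site j), where j_0 attains max_i z(m⁰)_i, and for n ≥ 1, j_n attains max_i z(m^n)_i and satisfies z(m^n)_{j_n} > M. Then the toppled sites j_0, j_1, …, j_{k−1} are pairwise distinct; consequently k ≤ L, every such maximal sequence (a ZFA run) terminates, and its final configuration m^N satisfies m^N_i ≤ m⁰_i + 1 for all i. -/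
/-- Toppling site `j`: increment the well number at `j` by one. -/
def topple {L : ℕ} (m : ZMod L → ℤ) (j : ZMod L) : ZMod L → ℤ :=
  fun i => m i + if i = j then 1 else 0

/-- A site that has gained one unit while every site gained at most one has not increased its
well coordinate. -/
theorem zco_le_of_le_add_one {L : ℕ} (α : ZMod L → ℝ) {m m' : ZMod L → ℤ}
    (hle : ∀ i, m' i ≤ m i + 1) {j : ZMod L} (hj : m j + 1 ≤ m' j) :
    zco α m' j ≤ zco α m j := by
  have h : lapZ m' j ≤ lapZ m j := by
    have h₁ := hle (j - 1)
    have h₂ := hle (j + 1)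
    unfold lapZ
    omega
  have h' : (lapZ m' j : ℝ) ≤ lapZ m j := by exact_mod_cast h
  unfold zco
  linarith

theorem zco_le_zmax {L : ℕ} [NeZero L] (α : ZMod L → ℝ) (m : ZMod L → ℤ) (i : ZMod L) :
    zco α m i ≤ zmax α m :=
  Finset.le_sup' (zco α m) (Finset.mem_univ i)

theorem topple_self {L : ℕ} (m : ZMod L → ℤ) (j : ZMod L) : topple m j j = m j + 1 := by
  simp [topple]

theorem topple_of_ne {L : ℕ} (m : ZMod L → ℤ) {i j : ZMod L} (h : i ≠ j) :
    topple m j i = m i := by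
  simp [topple, h]

theorem le_topple {L : ℕ} (m : ZMod L → ℤ) (j i : ZMod L) : m i ≤ topple m j i := by
  unfold topple
  split_ifs <;> omega

/-- **Each site topples at most once in a ZFA run (Proposition 3.2).**
Along any sequence of topples in which `j_0` attains `max_i z(m⁰)_i` and, for `n ≥ 1`,
`j_n` attains `max_i z(mⁿ)_i` with `z(mⁿ)_{j_n} > M = max_i z(m⁰)_i`, the toppled sites
are pairwise distinct; consequently `k ≤ L` (so every such maximal sequence terminates)
and the final configuration satisfies `m^k ≤ m⁰ + 1` componentwise. -/
theorem zfa_topples_distinct (L : ℕ) [NeZero L] (α : ZMod L → ℝ)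
    (m0 : ZMod L → ℤ) (k : ℕ)
    (ms : ℕ → ZMod L → ℤ) (js : ℕ → ZMod L)
    (hinit : ms 0 = m0)
    (hstep : ∀ n < k, ms (n + 1) = topple (ms n) (js n))
    (hfirst : 0 < k → ∀ i : ZMod L, zco α (ms 0) i ≤ zco α (ms 0) (js 0))
    (hmaxattain : ∀ n, 1 ≤ n → n < k → ∀ i : ZMod L, zco α (ms n) i ≤ zco α (ms n) (js n))
    (habove : ∀ n, 1 ≤ n → n < k → zmax α m0 < zco α (ms n) (js n)) :
    (∀ a < k, ∀ b < k, a ≠ b → js a ≠ js b) ∧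
    k ≤ L ∧
    (∀ i : ZMod L, ms k i ≤ m0 i + 1) := by
  have hfresh : ∀ n < k, (∀ i, ms n i ≤ m0 i + 1) → ms n (js n) ≤ m0 (js n) := by
    intro n hn hle
    rcases Nat.eq_zero_or_pos n with rfl | hpos
    · rw [hinit]
    · by_contra! hlt
      exact absurd (habove n hpos hn)
        (not_lt.2 ((zco_le_of_le_add_one α hle hlt).trans (zco_le_zmax α m0 _)))
  have hinv : ∀ n ≤ k, (∀ i, m0 i ≤ ms n i) ∧ (∀ i, ms n i ≤ m0 i + 1) ∧
      ∀ a < n, m0 (js a) + 1 ≤ ms n (js a) := by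
    intro n
    induction n with
    | zero => simp [hinit]
    | succ n ih =>
      intro hn
      obtain ⟨hlow, hle, hge⟩ := ih (by omega)
      have hnew := hfresh n hn hle
      rw [hstep n hn]
      refine ⟨fun i => (hlow i).trans (le_topple _ _ _), fun i => ?_, fun a ha => ?_⟩
      · by_cases hi : i = js n
        · subst hi
          rw [topple_self]
          omega
        · rw [topple_of_ne _ hi]
          exact hle i
      · rcases Nat.lt_succ_iff_lt_or_eq.1 ha with ha | rfl
        · exact (hge a ha).trans (le_topple _ _ _)
        · rw [topple_self]
          exact add_le_add_left (hlow _) 1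
  have hlt : ∀ a b, a < b → b < k → js a ≠ js b := by
    intro a b hab hb heq
    obtain ⟨-, hle, hge⟩ := hinv b hb.le
    have h₁ := hge a hab
    have h₂ := hfresh b hb hle
    rw [heq] at h₁
    omega
  have hne : ∀ a < k, ∀ b < k, a ≠ b → js a ≠ js b := fun a ha b hb hab =>
    hab.lt_or_gt.elim (fun h => hlt a b h hb) (fun h => (hlt b a h ha).symm)
  refine ⟨hne, ?_, (hinv k le_rfl).2.1⟩
  have hinj : Function.Injective fun a : Fin k => js a := fun a b hab => by
    by_contra h
    exact hne a a.2 b b.2 (fun h' => h (Fin.ext h')) hab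
  simpa [ZMod.card] using Fintype.card_le_of_injective _ hinj
end

section
/- Let K(s,t) = min(s,t) − s·t for s,t ∈ [0,1], and let φ : ℝ → ℝ be the 1-periodic function with φ(t) = 1/2 − t for t ∈ [0,1). Then for every r ∈ [0,1], ∫₀¹∫₀¹ K(s,t) φ(s) φ(t − r) ds dt = (1 − 30r² + 60r³ − 30r⁴)/720. (This is the covariance E G(0)G(r) of the mean-zero stationary Gaussian process G(r) = ∫₀¹ B(t) φ(t − r) dt, B a standard Brownian bridge, arising in the scaling limit of the flat-to-threshold polarization.) -/
/-- The covariance kernel of the standard Brownian bridge: `K(s,t) = min(s,t) − s t`. -/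
noncomputable def Kbb (s t : ℝ) : ℝ := min s t - s * t

/-- The 1-periodic sawtooth `φ` with `φ(t) = 1/2 − t` for `t ∈ [0,1)`. -/
noncomputable def phiP (t : ℝ) : ℝ := 1 / 2 - Int.fract t

open MeasureTheory intervalIntegral in
/-- A function agreeing with a quartic polynomial on `(a, b)` is integrable there, with the integral
given by the primitive of the polynomial. -/
theorem integral_eq_of_eq_quartic {f : ℝ → ℝ} {a b : ℝ} (c₀ c₁ c₂ c₃ c₄ : ℝ) (hab : a ≤ b)
    (h : ∀ x, a < x → x < b → f x = c₀ + c₁ * x + c₂ * x ^ 2 + c₃ * x ^ 3 + c₄ * x ^ 4) :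
    IntervalIntegrable f volume a b ∧
      ∫ x in a..b, f x = c₀ * (b - a) + c₁ * (b ^ 2 - a ^ 2) / 2 + c₂ * (b ^ 3 - a ^ 3) / 3
        + c₃ * (b ^ 4 - a ^ 4) / 4 + c₄ * (b ^ 5 - a ^ 5) / 5 := by
  set g : ℝ → ℝ := fun x ↦ c₀ + c₁ * x + c₂ * x ^ 2 + c₃ * x ^ 3 + c₄ * x ^ 4
  have hgi : IntervalIntegrable g volume a b :=
    Continuous.intervalIntegrable (by fun_prop) a b
  have hfg : ∀ᵐ x ∂volume, x ∈ Set.uIoc a b → g x = f x := by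
    filter_upwards [Measure.ae_ne volume b] with x hxb hx
    rw [Set.uIoc_of_le hab] at hx
    exact (h x hx.1 (lt_of_le_of_ne hx.2 hxb)).symm
  refine ⟨hgi.congr_ae ((ae_restrict_iff' measurableSet_uIoc).2 hfg), ?_⟩
  rw [← integral_congr_ae hfg]
  have hd : ∀ x ∈ Set.uIcc a b, HasDerivAt (fun x ↦ c₀ * x + c₁ * x ^ 2 / 2 + c₂ * x ^ 3 / 3
      + c₃ * x ^ 4 / 4 + c₄ * x ^ 5 / 5) (g x) x := by
    intro x _
    have h₁ := (hasDerivAt_id' x).const_mul c₀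
    have h₂ := ((hasDerivAt_pow 2 x).const_mul c₁).div_const 2
    have h₃ := ((hasDerivAt_pow 3 x).const_mul c₂).div_const 3
    have h₄ := ((hasDerivAt_pow 4 x).const_mul c₃).div_const 4
    have h₅ := ((hasDerivAt_pow 5 x).const_mul c₄).div_const 5
    refine ((((h₁.add h₂).add h₃).add h₄).add h₅).congr_deriv ?_
    simp only [g]
    norm_num
    ring
  rw [integral_eq_sub_of_hasDerivAt hd hgi]
  ring

theorem phiP_of_mem {t : ℝ} (h₀ : 0 ≤ t) (h₁ : t < 1) : phiP t = 1 / 2 - t := by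
  rw [phiP, Int.fract_eq_self.2 ⟨h₀, h₁⟩]

theorem phiP_of_mem_neg {t : ℝ} (h₀ : -1 ≤ t) (h₁ : t < 0) : phiP t = -1 / 2 - t := by
  have : phiP t = phiP (t + 1) := by simp [phiP]
  rw [this, phiP_of_mem (by linarith) (by linarith)]
  ring

theorem Kbb_of_le {s t : ℝ} (h : s ≤ t) : Kbb s t = s - s * t := by
  rw [Kbb, min_eq_left h]

theorem Kbb_of_ge {s t : ℝ} (h : t ≤ s) : Kbb s t = t - s * t := by
  rw [Kbb, min_eq_right h]

open intervalIntegral in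
theorem integral_Kbb_mul_phiP_of_le {r s : ℝ} (p : ℝ) (hs : 0 ≤ s) (hsr : s ≤ r) (hr : r ≤ 1) :
    ∫ t in (0:ℝ)..1, Kbb s t * p * phiP (t - r)
      = p * ((1 / 2 + r) * (s - s ^ 2) / 2 - (s - s ^ 3) / 6
        - (s * r - s ^ 2 / 2 - s * r ^ 2 / 2)) := by
  obtain ⟨i₁, e₁⟩ := integral_eq_of_eq_quartic (f := fun t ↦ Kbb s t * p * phiP (t - r))
    0 ((1 - s) * p * (r - 1 / 2)) (-(1 - s) * p) 0 0 hs (fun t h₀ h₁ ↦ by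
      rw [Kbb_of_ge h₁.le, phiP_of_mem_neg (by linarith) (by linarith)]; ring)
  obtain ⟨i₂, e₂⟩ := integral_eq_of_eq_quartic (f := fun t ↦ Kbb s t * p * phiP (t - r))
    (s * p * (r - 1 / 2)) (-s * p * (r + 1 / 2)) (s * p) 0 0 hsr (fun t h₀ h₁ ↦ by
      rw [Kbb_of_le h₀.le, phiP_of_mem_neg (by linarith) (by linarith)]; ring)
  obtain ⟨i₃, e₃⟩ := integral_eq_of_eq_quartic (f := fun t ↦ Kbb s t * p * phiP (t - r))
    (s * p * (r + 1 / 2)) (-s * p * (r + 3 / 2)) (s * p) 0 0 hr (fun t h₀ h₁ ↦ by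
      rw [Kbb_of_le (by linarith), phiP_of_mem (by linarith) (by linarith)]; ring)
  rw [← integral_add_adjacent_intervals (i₁.trans i₂) i₃,
    ← integral_add_adjacent_intervals i₁ i₂, e₁, e₂, e₃]
  ring

open intervalIntegral in
theorem integral_Kbb_mul_phiP_of_ge {r s : ℝ} (p : ℝ) (hr : 0 ≤ r) (hrs : r ≤ s) (hs : s ≤ 1) :
    ∫ t in (0:ℝ)..1, Kbb s t * p * phiP (t - r)
      = p * ((1 / 2 + r) * (s - s ^ 2) / 2 - (s - s ^ 3) / 6
        - (r ^ 2 / 2 - s * r ^ 2 / 2)) := by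
  obtain ⟨i₁, e₁⟩ := integral_eq_of_eq_quartic (f := fun t ↦ Kbb s t * p * phiP (t - r))
    0 ((1 - s) * p * (r - 1 / 2)) (-(1 - s) * p) 0 0 hr (fun t h₀ h₁ ↦ by
      rw [Kbb_of_ge (by linarith), phiP_of_mem_neg (by linarith) (by linarith)]; ring)
  obtain ⟨i₂, e₂⟩ := integral_eq_of_eq_quartic (f := fun t ↦ Kbb s t * p * phiP (t - r))
    0 ((1 - s) * p * (r + 1 / 2)) (-(1 - s) * p) 0 0 hrs (fun t h₀ h₁ ↦ by
      rw [Kbb_of_ge h₁.le, phiP_of_mem (by linarith) (by linarith)]; ring)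
  obtain ⟨i₃, e₃⟩ := integral_eq_of_eq_quartic (f := fun t ↦ Kbb s t * p * phiP (t - r))
    (s * p * (r + 1 / 2)) (-s * p * (r + 3 / 2)) (s * p) 0 0 hs (fun t h₀ h₁ ↦ by
      rw [Kbb_of_le h₀.le, phiP_of_mem (by linarith) (by linarith)]; ring)
  rw [← integral_add_adjacent_intervals (i₁.trans i₂) i₃,
    ← integral_add_adjacent_intervals i₁ i₂, e₁, e₂, e₃]
  ring

/-- **Covariance of the polarization process `G` (eqn 5.12).**
With `G(r) = ∫₀¹ B(t) φ(t − r) dt` for a standard Brownian bridge `B`, so that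
`E G(0) G(r) = ∫₀¹∫₀¹ K(s,t) φ(s) φ(t−r) ds dt`, one has, for `r ∈ [0,1]`,
`E G(0) G(r) = (1 − 30r² + 60r³ − 30r⁴)/720`. -/
theorem polarization_process_covariance :
    ∀ r ∈ Set.Icc (0:ℝ) 1,
      (∫ s in (0:ℝ)..1, ∫ t in (0:ℝ)..1, Kbb s t * phiP s * phiP (t - r))
        = (1 - 30 * r ^ 2 + 60 * r ^ 3 - 30 * r ^ 4) / 720 := by
  rintro r ⟨hr₀, hr₁⟩
  -- On `(0, r)` the inner integral is `(1/2 - s) (a s + b s² + s³/6)`.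
  obtain ⟨i₁, e₁⟩ := integral_eq_of_eq_quartic
    (f := fun s ↦ ∫ t in (0:ℝ)..1, Kbb s t * phiP s * phiP (t - r))
    0 ((1 / 12 - r / 2 + r ^ 2 / 2) / 2)
    ((1 / 4 - r / 2) / 2 - (1 / 12 - r / 2 + r ^ 2 / 2))
    (1 / 12 - (1 / 4 - r / 2)) (-1 / 6) hr₀ (fun s h₀ h₁ ↦ by
      rw [integral_Kbb_mul_phiP_of_le _ h₀.le h₁.le hr₁, phiP_of_mem h₀.le (by linarith)]; ring)
  -- On `(r, 1)` it is `(1/2 - s) (-r²/2 + a s + b s² + s³/6)`.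
  obtain ⟨i₂, e₂⟩ := integral_eq_of_eq_quartic
    (f := fun s ↦ ∫ t in (0:ℝ)..1, Kbb s t * phiP s * phiP (t - r))
    (-r ^ 2 / 4) ((1 / 12 + r / 2 + r ^ 2 / 2) / 2 + r ^ 2 / 2)
    ((-1 / 4 - r / 2) / 2 - (1 / 12 + r / 2 + r ^ 2 / 2))
    (1 / 12 - (-1 / 4 - r / 2)) (-1 / 6) hr₁ (fun s h₀ h₁ ↦ by
      rw [integral_Kbb_mul_phiP_of_ge _ hr₀ h₀.le h₁.le, phiP_of_mem (by linarith) h₁]; ring)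
  rw [← intervalIntegral.integral_add_adjacent_intervals i₁ i₂, e₁, e₂]
  ring
end

section
/- Fix u > 0. Let γ_L and γ_R be independent exponential random variables with rate u, and let (ρ_L, ρ_R) be uniformly distributed on the triangle T = {(x,y) ∈ ℝ² : x ≥ 0, y ≥ 0, x + y ≤ 1}, independent of (γ_L, γ_R). Then E[ min(γ_L, ρ_L) · min(γ_R, ρ_R) ] = (6 − 4u + u² − 6e^{−u} − 2u e^{−u})/u⁴. (This is the finite-size scaling function Φ(u) for the expected cumulative avalanche size in the threshold-to-threshold evolution, Φ(u) = lim_{L→∞} L^{−2} E[Σ(u/L)].) -/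
open MeasureTheory

/-- The exponential distribution with rate `u`: density `u e^{−ut}` on `[0,∞)`. -/
noncomputable def expMeas (u : ℝ) : Measure ℝ :=
  volume.withDensity fun t => ENNReal.ofReal (if 0 ≤ t then u * Real.exp (-(u * t)) else 0)

/-- The open-lower-left triangle `T = {(x,y) : x ≥ 0, y ≥ 0, x + y ≤ 1}`. -/
def triSet : Set (ℝ × ℝ) := {p | 0 ≤ p.1 ∧ 0 ≤ p.2 ∧ p.1 + p.2 ≤ 1}

/-- The uniform probability measure on the triangle `T` (constant density `2`). -/
noncomputable def triMeas : Measure (ℝ × ℝ) := (2 : ENNReal) • (volume.restrict triSet)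

lemma expMeas_eq_expMeasure (u : ℝ) : expMeas u = ProbabilityTheory.expMeasure u := by
  simp only [expMeas, ProbabilityTheory.expMeasure, ProbabilityTheory.gammaMeasure]
  congr 1
  funext t
  exact (ProbabilityTheory.exponentialPDF_eq u t).symm

lemma isProbabilityMeasure_expMeas {u : ℝ} (hu : 0 < u) : IsProbabilityMeasure (expMeas u) := by
  rw [expMeas_eq_expMeasure]
  exact ProbabilityTheory.isProbabilityMeasure_expMeasure hu

lemma measurable_expMeas_density (u : ℝ) :
    Measurable fun t : ℝ => ENNReal.ofReal (if 0 ≤ t then u * Real.exp (-(u * t)) else 0) :=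
  (Measurable.ite measurableSet_Ici (by fun_prop) measurable_const).ennreal_ofReal

lemma ae_nonneg_expMeas (u : ℝ) : ∀ᵐ t ∂(expMeas u), 0 ≤ t := by
  rw [expMeas, ae_withDensity_iff (measurable_expMeas_density u)]
  refine Filter.Eventually.of_forall fun t ht => ?_
  by_contra h
  simp [h] at ht

lemma integral_expMeas {u : ℝ} (hu : 0 < u) (f : ℝ → ℝ) :
    ∫ t, f t ∂(expMeas u) = ∫ t in Set.Ioi 0, u * Real.exp (-(u * t)) * f t := by
  rw [expMeas, integral_withDensity_eq_integral_toReal_smul (measurable_expMeas_density u)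
    (Filter.Eventually.of_forall fun _ => ENNReal.ofReal_lt_top), ← integral_Ici_eq_integral_Ioi,
    ← integral_indicator measurableSet_Ici]
  congr 1
  funext t
  by_cases h : 0 ≤ t
  · have : 0 ≤ u * Real.exp (-(u * t)) := by positivity
    simp [Set.indicator, h, this]
  · simp [Set.indicator, h]

lemma hasDerivAt_exp_neg_mul (u x : ℝ) :
    HasDerivAt (fun t => Real.exp (-(u * t))) (-(u * Real.exp (-(u * x)))) x := by
  have h : HasDerivAt (fun t => -(u * t)) (-u) x := by
    convert! (hasDerivAt_id x).const_mul (-u) using 1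
    · funext t
      simp
    · simp
  convert! h.exp using 1
  ring

lemma integral_min_expMeas {u : ℝ} (hu : 0 < u) {r : ℝ} (hr : 0 ≤ r) :
    ∫ t, min t r ∂(expMeas u) = (1 - Real.exp (-(u * r))) / u := by
  have htend : Filter.Tendsto (fun t => -r * Real.exp (-(u * t))) Filter.atTop (nhds (-r * 0)) := by
    refine Filter.Tendsto.const_mul _ (Real.tendsto_exp_atBot.comp ?_)
    exact Filter.tendsto_neg_atTop_atBot.comp (Filter.tendsto_id.const_mul_atTop hu)
  have hderiv : ∀ x ∈ Set.Ici r, HasDerivAt (fun t => -r * Real.exp (-(u * t)))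
      (u * Real.exp (-(u * x)) * r) x := fun x _ => by
    convert! (hasDerivAt_exp_neg_mul u x).const_mul (-r) using 1
    ring
  have hpos : ∀ x ∈ Set.Ioi r, 0 ≤ u * Real.exp (-(u * x)) * r := fun x _ => by positivity
  have htail := integral_Ioi_of_hasDerivAt_of_nonneg' hderiv hpos htend
  have hint := integrableOn_Ioi_deriv_of_nonneg' hderiv hpos htend
  have hcongr : Set.EqOn (fun x => u * Real.exp (-(u * x)) * min x r)
      (fun x => u * Real.exp (-(u * x)) * r) (Set.Ioi r) := fun x hx => by
    simp [min_eq_right (le_of_lt (Set.mem_Ioi.1 hx))]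
  have hhead : ∫ x in (0 : ℝ)..r, u * Real.exp (-(u * x)) * min x r
      = -(r + 1 / u) * Real.exp (-(u * r)) + 1 / u := by
    rw [intervalIntegral.integral_congr (g := fun x => u * Real.exp (-(u * x)) * x)]
    · rw [intervalIntegral.integral_eq_sub_of_hasDerivAt
        (f := fun x => -((x + 1 / u) * Real.exp (-(u * x))))]
      · simp; ring
      · intro x _
        convert! (((hasDerivAt_id x).add_const (1 / u)).mul (hasDerivAt_exp_neg_mul u x)).neg using 1
        simp only [id_eq]
        field_simp
        ring
      · exact Continuous.intervalIntegrable (by fun_prop) _ _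
    · intro x hx
      rw [Set.uIcc_of_le hr] at hx
      simp [min_eq_left hx.2]
  rw [integral_expMeas hu, ← Set.Ioc_union_Ioi_eq_Ioi hr,
    setIntegral_union (Set.Ioc_disjoint_Ioi le_rfl) measurableSet_Ioi
      (Continuous.integrableOn_Ioc (by fun_prop))
      (hint.congr_fun hcongr.symm measurableSet_Ioi),
    ← intervalIntegral.integral_of_le hr, hhead, setIntegral_congr_fun measurableSet_Ioi hcongr,
    htail]
  field_simp
  ring

lemma isClosed_triSet : IsClosed triSet :=
  (isClosed_le continuous_const continuous_fst).inter
    ((isClosed_le continuous_const continuous_snd).inter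
      (isClosed_le (continuous_fst.add continuous_snd) continuous_const))

lemma isCompact_triSet : IsCompact triSet := by
  refine (isCompact_Icc (a := ((0 : ℝ), (0 : ℝ))) (b := (1, 1))).of_isClosed_subset
    isClosed_triSet ?_
  rintro ⟨x, y⟩ ⟨hx, hy, hxy⟩
  simp only at hx hy hxy
  exact ⟨⟨hx, hy⟩, ⟨by simp only; linarith, by simp only; linarith⟩⟩

instance : IsFiniteMeasure triMeas := by
  have : IsFiniteMeasure (volume.restrict triSet) :=
    isFiniteMeasure_restrict.2 isCompact_triSet.measure_lt_top.ne
  exact Measure.smul_finite _ (by simp)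

lemma ae_mem_triSet : ∀ᵐ p ∂triMeas, p ∈ triSet :=
  Measure.ae_smul_measure (ae_restrict_mem isClosed_triSet.measurableSet) _

lemma integral_triMeas {f : ℝ × ℝ → ℝ} (hf : Continuous f) :
    ∫ p, f p ∂triMeas = 2 * ∫ x in (0 : ℝ)..1, ∫ y in (0 : ℝ)..(1 - x), f (x, y) := by
  rw [triMeas, integral_smul_measure, ← integral_indicator isClosed_triSet.measurableSet,
    Measure.volume_eq_prod, integral_prod]
  · rw [intervalIntegral.integral_of_le zero_le_one, ← integral_Icc_eq_integral_Ioc,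
      ← integral_indicator measurableSet_Icc]
    simp only [ENNReal.toReal_ofNat, smul_eq_mul]
    congr 2
    funext x
    by_cases hx : x ∈ Set.Icc (0 : ℝ) 1
    · rw [Set.indicator_of_mem hx, intervalIntegral.integral_of_le (by linarith [hx.2]),
        ← integral_Icc_eq_integral_Ioc, ← integral_indicator measurableSet_Icc]
      congr 1
      funext y
      have : (x, y) ∈ triSet ↔ y ∈ Set.Icc (0 : ℝ) (1 - x) := by
        simp only [triSet, Set.mem_ofPred_eq, Set.mem_Icc, hx.1, true_and, le_sub_iff_add_le']
      simp only [Set.indicator, this]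
    · rw [Set.indicator_of_notMem hx]
      refine integral_eq_zero_of_ae (Filter.Eventually.of_forall fun y => ?_)
      refine Set.indicator_of_notMem (fun h => hx ?_) _
      exact ⟨h.1, by linarith [h.2.1, h.2.2]⟩
  · rw [← Measure.volume_eq_prod, integrable_indicator_iff isClosed_triSet.measurableSet]
    exact hf.continuousOn.integrableOn_compact isCompact_triSet

lemma integral_triMeas_one_sub_exp {u : ℝ} (hu : 0 < u) :
    ∫ p : ℝ × ℝ, (1 - Real.exp (-(u * p.1))) / u * ((1 - Real.exp (-(u * p.2))) / u) ∂triMeas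
      = (6 - 4 * u + u ^ 2 - 6 * Real.exp (-u) - 2 * u * Real.exp (-u)) / u ^ 4 := by
  rw [integral_triMeas (by fun_prop)]
  have hinner (c : ℝ) : ∫ y in (0 : ℝ)..c, (1 - Real.exp (-(u * y))) / u
      = (c + (Real.exp (-(u * c)) - 1) / u) / u := by
    rw [intervalIntegral.integral_eq_sub_of_hasDerivAt
      (f := fun y => (y + Real.exp (-(u * y)) / u) / u)]
    · simp; ring
    · intro x _
      convert! (((hasDerivAt_id x).add ((hasDerivAt_exp_neg_mul u x).div_const u)).div_const u)
        using 1
      field_simp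
      ring
    · exact Continuous.intervalIntegrable (by fun_prop) _ _
  simp only [intervalIntegral.integral_const_mul, hinner]
  rw [intervalIntegral.integral_eq_sub_of_hasDerivAt
    (f := fun x => (u * (x - x ^ 2 / 2) + Real.exp (-u) * Real.exp (-(-u * x)) / u - x
      + (1 - x) * Real.exp (-(u * x)) - 2 * Real.exp (-(u * x)) / u - Real.exp (-u) * x) / u ^ 3)]
  · have h : Real.exp (-u) * Real.exp u = 1 := by rw [← Real.exp_add]; simp
    simp only [mul_one, mul_zero, neg_zero, neg_neg, Real.exp_zero, h]
    field_simp
    ring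
  · intro x _
    have hE := hasDerivAt_exp_neg_mul u x
    have hid := hasDerivAt_id x
    have h1 : Real.exp (-(u * (1 - x))) = Real.exp (-u) * Real.exp (-(-u * x)) := by
      rw [← Real.exp_add]; ring_nf
    have h2 : Real.exp (-(u * x)) * Real.exp (-(-u * x)) = 1 := by
      rw [← Real.exp_add]; simp
    rw [neg_mul, neg_neg] at h1 h2
    convert! (((((((hid.sub ((hid.pow 2).div_const 2)).const_mul u).add
      (((hasDerivAt_exp_neg_mul (-u) x).const_mul (Real.exp (-u))).div_const u)).sub hid).add
      ((hid.const_sub 1).mul hE)).sub ((hE.const_mul 2).div_const u)).sub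
      (hid.const_mul (Real.exp (-u)))).div_const (u ^ 3) using 1
    rw [h1]
    simp only [id_eq, neg_mul, neg_neg]
    field_simp
    linear_combination (-2 * Real.exp (-u)) * h2
  · exact Continuous.intervalIntegrable (by fun_prop) _ _

lemma integrable_min_mul_min {u : ℝ} (hu : 0 < u) :
    Integrable (fun p : ℝ × ℝ × ℝ × ℝ => min p.1 p.2.2.1 * min p.2.1 p.2.2.2)
      ((expMeas u).prod ((expMeas u).prod triMeas)) := by
  have := isProbabilityMeasure_expMeas hu
  refine Integrable.of_bound (by fun_prop) 1 ?_
  have hsnd := Measure.quasiMeasurePreserving_snd (μ := expMeas u)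
    (ν := (expMeas u).prod triMeas)
  filter_upwards [Measure.quasiMeasurePreserving_fst.ae (ae_nonneg_expMeas u),
    hsnd.ae (Measure.quasiMeasurePreserving_fst.ae (ae_nonneg_expMeas u)),
    hsnd.ae (Measure.quasiMeasurePreserving_snd.ae ae_mem_triSet)] with p ha hb hT
  obtain ⟨hx, hy, hxy⟩ := hT
  rw [Real.norm_of_nonneg (mul_nonneg (le_min ha hx) (le_min hb hy))]
  refine mul_le_one₀ ((min_le_right _ _).trans ?_) (le_min hb hy) ((min_le_right _ _).trans ?_) <;>
    linarith

/-- **The finite-size scaling function `Φ(u)` (Proposition 5.5, eqn 5.16).**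
If `γ_L, γ_R` are independent exponentials of rate `u` and `(ρ_L, ρ_R)` is uniform on
the triangle `T`, independent of them, then
`E[min(γ_L,ρ_L)·min(γ_R,ρ_R)] = (6 − 4u + u² − 6e^{−u} − 2u e^{−u})/u⁴`. -/
theorem scaling_function_Phi (u : ℝ) (hu : 0 < u) :
    (∫ p : ℝ × ℝ × ℝ × ℝ,
        min p.1 p.2.2.1 * min p.2.1 p.2.2.2
        ∂((expMeas u).prod ((expMeas u).prod triMeas)))
      = (6 - 4 * u + u ^ 2 - 6 * Real.exp (-u) - 2 * u * Real.exp (-u)) / u ^ 4 := by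
  have := isProbabilityMeasure_expMeas hu
  have hint := integrable_min_mul_min hu
  rw [integral_prod_symm _ hint, integral_prod_symm _ hint.integral_prod_right,
    ← integral_triMeas_one_sub_exp hu]
  refine integral_congr_ae ?_
  filter_upwards [ae_mem_triSet] with p hp
  simp only [integral_mul_const, integral_const_mul, integral_min_expMeas hu hp.1,
    integral_min_expMeas hu hp.2.1]
end

section
/- Let (ρ_L, ρ_R) be uniformly distributed on the triangle T = {(x,y) ∈ ℝ² : x ≥ 0, y ≥ 0, x + y ≤ 1}. Then the product ρ_L·ρ_R has a density on (0, 1/4] given by p₀(s) = 2·ln((1 + √(1 − 4s))/(1 − √(1 − 4s))); i.e., for every bounded measurable f : ℝ → ℝ, E[f(ρ_L ρ_R)] = ∫₀^{1/4} f(s) · 2 ln((1 + √(1 − 4s))/(1 − √(1 − 4s))) ds. (This is the distribution of the complete threshold-to-threshold cumulative avalanche size in the scaling limit, matching the avalanche size distribution of Dhar's one-dimensional Abelian sandpile.) -/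
open MeasureTheory

open Set

/-- Scaling the variable of a Lebesgue integral on `ℝ` by a positive factor. -/
lemma lintegral_comp_mul_left_of_pos {g : ℝ → ENNReal} (hg : Measurable g) {x : ℝ} (hx : 0 < x) :
    ∫⁻ y, g (x * y) = ∫⁻ s, ENNReal.ofReal x⁻¹ * g s := by
  rw [← lintegral_map hg (measurable_const_mul x), Real.map_volume_mul_left hx.ne',
    lintegral_smul_measure, abs_of_pos (inv_pos.2 hx), lintegral_const_mul _ hg, smul_eq_mul]

lemma lintegral_inv_Icc {a b : ℝ} (ha : 0 < a) (hab : a ≤ b) :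
    ∫⁻ x in Icc a b, ENNReal.ofReal x⁻¹ = ENNReal.ofReal (Real.log (b / a)) := by
  have hint : IntegrableOn (fun x : ℝ => x⁻¹) (Icc a b) := by
    refine ContinuousOn.integrableOn_Icc (continuousOn_id.inv₀ fun x hx => ?_)
    exact (ha.trans_le hx.1).ne'
  rw [← integral_inv_of_pos ha (ha.trans_le hab), intervalIntegral.integral_of_le hab,
    ← integral_Icc_eq_integral_Ioc]
  refine (ofReal_integral_eq_lintegral_ofReal hint ?_).symm
  filter_upwards [ae_restrict_mem measurableSet_Icc] with x hx
  exact inv_nonneg.2 (ha.trans_le hx.1).le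

/-- The solution set of `s ≤ x (1 - x)` is the interval between the roots of the quadratic. -/
lemma setOf_le_mul_one_sub {s : ℝ} (hs : s ≤ 1 / 4) :
    {x : ℝ | s ≤ x * (1 - x)} =
      Icc ((1 - Real.sqrt (1 - 4 * s)) / 2) ((1 + Real.sqrt (1 - 4 * s)) / 2) := by
  have hr := Real.sq_sqrt (show 0 ≤ 1 - 4 * s by linarith)
  have hr0 := Real.sqrt_nonneg (1 - 4 * s)
  ext x
  simp only [mem_ofPred_eq, mem_Icc]
  constructor
  · intro h
    have := abs_le_of_sq_le_sq' (show (2 * x - 1) ^ 2 ≤ Real.sqrt (1 - 4 * s) ^ 2 by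
      nlinarith) hr0
    constructor <;> linarith [this.1, this.2]
  · rintro ⟨h1, h2⟩
    nlinarith [mul_nonneg (sub_nonneg.2 h1) (sub_nonneg.2 h2)]

lemma sqrt_one_sub_lt_one {s : ℝ} (hs : 0 < s) : Real.sqrt (1 - 4 * s) < 1 := by
  rw [Real.sqrt_lt' one_pos]; linarith

/-- The region `{(x, s) : 0 < x, 0 ≤ s ≤ x (1 - x)}`, the image of the triangle under
`(x, y) ↦ (x, x y)`. -/
def prodRegion : Set (ℝ × ℝ) := {q | 0 < q.1 ∧ 0 ≤ q.2 ∧ q.2 ≤ q.1 * (1 - q.1)}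

lemma measurableSet_prodRegion : MeasurableSet prodRegion := by
  unfold prodRegion
  measurability

lemma measurableSet_triSet : MeasurableSet triSet := by
  unfold triSet
  measurability

lemma lintegral_triSet_eq_lintegral_prodRegion {g : ℝ → ENNReal} (hg : Measurable g) :
    ∫⁻ p in triSet, g (p.1 * p.2) =
      ∫⁻ s, ∫⁻ x, prodRegion.indicator (fun q => ENNReal.ofReal q.1⁻¹ * g q.2) (x, s) := by
  have hmeas : Measurable
      (prodRegion.indicator fun q : ℝ × ℝ => ENNReal.ofReal q.1⁻¹ * g q.2) :=
    Measurable.indicator (by fun_prop) measurableSet_prodRegion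
  rw [← lintegral_indicator measurableSet_triSet, Measure.volume_eq_prod,
    lintegral_prod _ (Measurable.indicator (by fun_prop) measurableSet_triSet).aemeasurable,
    lintegral_lintegral_swap (f := fun s x => prodRegion.indicator
      (fun q => ENNReal.ofReal q.1⁻¹ * g q.2) (x, s))
      (hmeas.comp measurable_swap).aemeasurable]
  refine lintegral_congr_ae ?_
  filter_upwards [Measure.ae_ne volume (0 : ℝ)] with x hx0
  rcases lt_or_gt_of_ne hx0 with hx | hx
  · have h1 : ∀ y, (x, y) ∉ triSet := fun y h => hx.not_ge h.1
    have h2 : ∀ s, (x, s) ∉ prodRegion := fun s h => hx.not_gt h.1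
    simp [h1, h2]
  · have hsec : MeasurableSet {s : ℝ | (x, s) ∈ prodRegion} :=
      measurable_prodMk_left measurableSet_prodRegion
    refine Eq.trans (lintegral_congr fun y => ?_)
      ((lintegral_comp_mul_left_of_pos (hg.indicator hsec) hx).trans (lintegral_congr fun s => ?_))
    · have hiff : (x, y) ∈ triSet ↔ (x, x * y) ∈ prodRegion := by
        simp only [triSet, prodRegion, mem_ofPred_eq]
        constructor
        · rintro ⟨-, h1, h2⟩
          exact ⟨hx, by positivity, mul_le_mul_of_nonneg_left (by linarith) hx.le⟩
        · rintro ⟨-, h1, h2⟩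
          exact ⟨hx.le, nonneg_of_mul_nonneg_right h1 hx,
            by linarith [le_of_mul_le_mul_left h2 hx]⟩
      by_cases h : (x, x * y) ∈ prodRegion <;> simp [hiff, h]
    · by_cases h : (x, s) ∈ prodRegion <;> simp [h]

lemma lintegral_prodRegion_section (g : ℝ → ENNReal) {s : ℝ} (hs0 : s ≠ 0) :
    ∫⁻ x, prodRegion.indicator (fun q => ENNReal.ofReal q.1⁻¹ * g q.2) (x, s) =
      (Ioc (0 : ℝ) (1 / 4)).indicator (fun s => ENNReal.ofReal (Real.log
        ((1 + Real.sqrt (1 - 4 * s)) / (1 - Real.sqrt (1 - 4 * s)))) * g s) s := by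
  by_cases hs : s ∈ Ioc (0 : ℝ) (1 / 4)
  · have hr := sqrt_one_sub_lt_one hs.1
    have hr0 := Real.sqrt_nonneg (1 - 4 * s)
    have hsec : ∀ x, (x, s) ∈ prodRegion ↔
        x ∈ Icc ((1 - Real.sqrt (1 - 4 * s)) / 2) ((1 + Real.sqrt (1 - 4 * s)) / 2) := by
      intro x
      rw [← setOf_le_mul_one_sub hs.2]
      simp only [prodRegion, mem_ofPred_eq]
      refine ⟨fun h => h.2.2, fun h => ⟨?_, hs.1.le, h⟩⟩
      nlinarith [hs.1, sq_nonneg x]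
    have hind : ∀ x, prodRegion.indicator (fun q => ENNReal.ofReal q.1⁻¹ * g q.2) (x, s) =
        (Icc ((1 - Real.sqrt (1 - 4 * s)) / 2) ((1 + Real.sqrt (1 - 4 * s)) / 2)).indicator
          (fun x => ENNReal.ofReal x⁻¹ * g s) x := by
      intro x
      simp only [indicator, hsec]
    simp_rw [hind]
    rw [lintegral_indicator measurableSet_Icc, lintegral_mul_const _ (by fun_prop),
      lintegral_inv_Icc (by linarith) (by linarith), indicator_of_mem hs,
      div_div_div_cancel_right₀ two_ne_zero]
  · have hsec : ∀ x, (x, s) ∉ prodRegion := by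
      rintro x ⟨-, h1, h2⟩
      simp only at h1 h2
      exact hs ⟨lt_of_le_of_ne h1 hs0.symm, by nlinarith [sq_nonneg (2 * x - 1)]⟩
    rw [indicator_of_notMem hs]
    simp [hsec]

/-- The law of `ρ_L ρ_R` on the triangle is absolutely continuous with the stated density. -/
lemma map_mul_triMeas :
    triMeas.map (fun p => p.1 * p.2) =
      (volume.restrict (Ioc (0 : ℝ) (1 / 4))).withDensity (fun s => ENNReal.ofReal
        (2 * Real.log ((1 + Real.sqrt (1 - 4 * s)) / (1 - Real.sqrt (1 - 4 * s))))) := by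
  refine Measure.ext_of_lintegral _ fun g hg => ?_
  rw [lintegral_map hg (by fun_prop), triMeas, lintegral_smul_measure,
    lintegral_triSet_eq_lintegral_prodRegion hg,
    lintegral_withDensity_eq_lintegral_mul _ (by fun_prop) hg,
    lintegral_congr_ae ((Measure.ae_ne volume (0 : ℝ)).mono fun s hs =>
      lintegral_prodRegion_section g hs),
    lintegral_indicator measurableSet_Ioc, smul_eq_mul,
    ← lintegral_const_mul _ (by fun_prop)]
  refine lintegral_congr fun s => ?_
  rw [Pi.mul_apply, ENNReal.ofReal_mul zero_le_two, ENNReal.ofReal_ofNat, mul_assoc]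

/-- **Density of the total threshold-to-threshold avalanche size (eqn 5.22).**
If `(ρ_L, ρ_R)` is uniform on the triangle `T`, then the product `ρ_L ρ_R` has density
`p₀(s) = 2 ln((1 + √(1−4s))/(1 − √(1−4s)))` on `(0, 1/4]`: for every bounded measurable
`f`, `E[f(ρ_L ρ_R)] = ∫₀^{1/4} f(s) p₀(s) ds`. -/
theorem product_density_on_triangle
    (f : ℝ → ℝ) (hf : Measurable f) (hbd : ∃ C : ℝ, ∀ x : ℝ, |f x| ≤ C) :
    (∫ p : ℝ × ℝ, f (p.1 * p.2) ∂triMeas)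
      = ∫ s in (0:ℝ)..(1/4 : ℝ),
          f s * (2 * Real.log ((1 + Real.sqrt (1 - 4 * s)) / (1 - Real.sqrt (1 - 4 * s)))) := by
  rw [← integral_map (f := f) (φ := fun p : ℝ × ℝ => p.1 * p.2) (by fun_prop)
    hf.aestronglyMeasurable, map_mul_triMeas,
    integral_withDensity_eq_integral_toReal_smul (by fun_prop)
      (ae_of_all _ fun _ => ENNReal.ofReal_lt_top),
    intervalIntegral.integral_of_le (by norm_num)]
  refine setIntegral_congr_fun measurableSet_Ioc fun s hs => ?_
  have hr := sqrt_one_sub_lt_one hs.1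
  have hr0 := Real.sqrt_nonneg (1 - 4 * s)
  have hlog : 0 ≤ Real.log ((1 + Real.sqrt (1 - 4 * s)) / (1 - Real.sqrt (1 - 4 * s))) :=
    Real.log_nonneg ((one_le_div (by linarith)).2 (by linarith))
  simp only [smul_eq_mul]
  rw [ENNReal.toReal_ofReal (by positivity), mul_comm]
end
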